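/- Let d ≥ 3, α = (d-2)/2, let P be a homogeneous polynomial of degree l on ℝ^d, and let f be a Schwartz function on ℝ. Then for every y ∈ ℝ^d, (2π)^{-d/2} ∫_{ℝ^d} f(|x|) P(x) e^{i(y|x)} dx = i^l Σ_{k=0}^{⌊l/2⌋} (-1)^k H_{α+l-2k}(s ↦ s^{2k} f(s))(|y|) · h_{l-2k}(P)(y), where h_{l-2k}(P) are the harmonic components of P in its canonical decomposition P = Σ_{k=0}^{⌊l/2⌋} r^{2k} h_{l-2k}(P), given by h_{l-2k}(P) = Σ_{j=0}^{⌊l/2⌋-k} (-1)^j (α+l-2k)Γ(α+l-2k-j)/(4^{k+j} k! j! Γ(α+l+1-k)) r^{2j} Δ^{k+j} P. -/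

import Mathlib

open MeasureTheory MvPolynomial Finset
open scoped RealInnerProductSpace SchwartzMap

noncomputable section

/-- The Euclidean Laplacian `Δ = Σ_{j=1}^d ∂²/∂x_j²` acting on polynomials on `ℝ^d`. -/
def lap {d : ℕ} (P : MvPolynomial (Fin d) ℝ) : MvPolynomial (Fin d) ℝ :=
  ∑ i, pderiv i (pderiv i P)

/-- The polynomial `r² = |x|² = Σ_j x_j²` on `ℝ^d`. -/
def r2 (d : ℕ) : MvPolynomial (Fin d) ℝ := ∑ i, X i * X i

/-- The coefficients `e^l_j(k) = (-1)^j (α+l-2k) Γ(α+l-2k-j) / (4^{k+j} k! j! Γ(α+l+1-k))`. -/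
def ecoef (α : ℝ) (l j k : ℕ) : ℝ :=
  (-1) ^ j * (α + l - 2 * k) * Real.Gamma (α + l - 2 * k - j) /
    (4 ^ (k + j) * (Nat.factorial k) * (Nat.factorial j) * Real.Gamma (α + l + 1 - k))

/-- The harmonic component `h_{l-2k}(P) = Σ_{j=0}^{⌊l/2⌋-k} e^l_j(k) r^{2j} Δ^{k+j} P`. -/
def harmComp (d : ℕ) (α : ℝ) (l k : ℕ) (P : MvPolynomial (Fin d) ℝ) :
    MvPolynomial (Fin d) ℝ :=
  ∑ j ∈ Finset.range (l / 2 - k + 1), C (ecoef α l j k) * (r2 d) ^ j * lap^[k + j] P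

/-- The spherical Bessel function
`j_ν(t) = Γ(ν+1)(t/2)^{-ν} J_ν(t) = Γ(ν+1) Σ_{k=0}^∞ (-1)^k/(Γ(k+1)Γ(k+ν+1)) (t/2)^{2k}`. -/
def sphericalBesselJ (ν t : ℝ) : ℝ :=
  Real.Gamma (ν + 1) *
    ∑' k : ℕ, (-1) ^ k / (Real.Gamma (k + 1) * Real.Gamma (k + ν + 1)) * (t / 2) ^ (2 * k)

/-- The Hankel transform of order `ν`:
`H_ν(φ)(t) = (2^{-ν}/Γ(ν+1)) ∫_0^∞ φ(s) j_ν(st) s^{2ν+1} ds`. -/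
def hankel (ν : ℝ) (φ : ℝ → ℝ) (t : ℝ) : ℝ :=
  (2 : ℝ) ^ (-ν) / Real.Gamma (ν + 1) *
    ∫ s in Set.Ioi (0 : ℝ), φ s * sphericalBesselJ ν (s * t) * s ^ (2 * ν + 1)

lemma lap_add' {d : ℕ} (P Q : MvPolynomial (Fin d) ℝ) : lap (P + Q) = lap P + lap Q := by
  simp [lap, Finset.sum_add_distrib]

lemma lap_zero' {d : ℕ} : lap (0 : MvPolynomial (Fin d) ℝ) = 0 := by
  simp [lap]

lemma lap_sum' {d : ℕ} {ι : Type*} (s : Finset ι) (P : ι → MvPolynomial (Fin d) ℝ) :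
    lap (∑ i ∈ s, P i) = ∑ i ∈ s, lap (P i) := by
  classical
  induction s using Finset.induction_on with
  | empty => simp [lap_zero']
  | insert a s ha ih => rw [Finset.sum_insert ha, Finset.sum_insert ha, lap_add', ih]

lemma lap_C_mul' {d : ℕ} (c : ℝ) (P : MvPolynomial (Fin d) ℝ) : lap (C c * P) = C c * lap P := by
  simp [lap, Finset.mul_sum]

lemma lap_homog {d : ℕ} {P : MvPolynomial (Fin d) ℝ} {n : ℕ} (h : P.IsHomogeneous n) :
    (lap P).IsHomogeneous (n - 2) := by
  unfold lap
  apply IsHomogeneous.sum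
  intro i _
  have := (h.pderiv (i := i)).pderiv (i := i)
  simpa [Nat.sub_sub] using this

lemma lap_iter_homog {d : ℕ} {P : MvPolynomial (Fin d) ℝ} {n : ℕ} (h : P.IsHomogeneous n) (m : ℕ) :
    (lap^[m] P).IsHomogeneous (n - 2 * m) := by
  induction m with
  | zero => simpa using h
  | succ m ih =>
    rw [Function.iterate_succ_apply']
    have := lap_homog ih
    rwa [Nat.sub_sub] at this

lemma pderiv_homog_zero {d : ℕ} {P : MvPolynomial (Fin d) ℝ} (h : P.IsHomogeneous 0) (i : Fin d) :
    pderiv i P = 0 := by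
  rw [← totalDegree_zero_iff_isHomogeneous, totalDegree_eq_zero_iff_eq_C] at h
  rw [h]; simp

lemma lap_homog_le_one {d : ℕ} {P : MvPolynomial (Fin d) ℝ} {n : ℕ} (h : P.IsHomogeneous n)
    (hn : n ≤ 1) : lap P = 0 := by
  unfold lap
  apply Finset.sum_eq_zero
  intro i _
  apply pderiv_homog_zero
  have := (h.pderiv (i := i))
  rwa [Nat.sub_eq_zero_of_le hn] at this

lemma r2_homog (d : ℕ) : (r2 d).IsHomogeneous 2 := by
  unfold r2
  apply IsHomogeneous.sum
  intro i _
  exact (isHomogeneous_X ℝ i).mul (isHomogeneous_X ℝ i)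

lemma pderiv_r2 {d : ℕ} (i : Fin d) : pderiv i (r2 d) = 2 * X i := by
  classical
  unfold r2
  rw [map_sum, Finset.sum_eq_single i]
  · rw [pderiv_mul, pderiv_X_self]; ring
  · intro j _ hj
    rw [pderiv_mul, pderiv_X_of_ne hj]; ring
  · simp

lemma lap_r2_mul {d : ℕ} {Q : MvPolynomial (Fin d) ℝ} {q : ℕ} (h : Q.IsHomogeneous q) :
    lap (r2 d * Q) = r2 d * lap Q + C (2 * (d : ℝ) + 4 * q) * Q := by
  have h1 : ∀ i : Fin d, pderiv i (pderiv i (r2 d * Q)) =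
      r2 d * pderiv i (pderiv i Q) + 4 * (X i * pderiv i Q) + 2 * Q := by
    intro i
    have h2 : pderiv i (2 : MvPolynomial (Fin d) ℝ) = 0 := by
      exact (pderiv i).map_natCast 2
    rw [pderiv_mul, pderiv_r2, map_add, pderiv_mul, pderiv_mul, pderiv_mul, h2, pderiv_r2,
      pderiv_X_self]
    ring
  unfold lap
  simp_rw [h1]
  rw [Finset.sum_add_distrib, Finset.sum_add_distrib, ← Finset.mul_sum, ← Finset.mul_sum,
    h.sum_X_mul_pderiv]
  have c2 : (C (2 : ℝ) : MvPolynomial (Fin d) ℝ) = 2 := map_ofNat C 2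
  have c4 : (C (4 : ℝ) : MvPolynomial (Fin d) ℝ) = 4 := map_ofNat C 4
  simp [c2, c4]
  ring

lemma lap_r2_pow_mul {d : ℕ} {Q : MvPolynomial (Fin d) ℝ} {q : ℕ} (h : Q.IsHomogeneous q) (j : ℕ) :
    lap (r2 d ^ (j + 1) * Q) = r2 d ^ (j + 1) * lap Q +
      C (4 * ((j : ℝ) + 1) * (((d : ℝ) - 2) / 2 + (j + 1) + q)) * (r2 d ^ j * Q) := by
  induction j with
  | zero =>
    have := lap_r2_mul h
    simp only [zero_add, pow_one, pow_zero, one_mul, this]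
    congr 3
    push_cast; ring
  | succ j ih =>
    have hh : (r2 d ^ (j + 1) * Q).IsHomogeneous (2 * (j + 1) + q) := ((r2_homog d).pow (j + 1)).mul h
    have e : r2 d ^ (j + 1 + 1) * Q = r2 d * (r2 d ^ (j + 1) * Q) := by ring
    rw [e, lap_r2_mul hh, ih]
    have e2 : C (4 * (((j + 1 : ℕ) : ℝ) + 1) * (((d : ℝ) - 2) / 2 + (((j + 1 : ℕ) : ℝ) + 1) + q)) =
      C (4 * ((j : ℝ) + 1) * (((d : ℝ) - 2) / 2 + (j + 1) + q)) +
      (C (2 * (d : ℝ) + 4 * ((2 * (j + 1) + q : ℕ) : ℝ)) : MvPolynomial (Fin d) ℝ) := by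
      rw [← C_add]; congr 1; push_cast; ring
    rw [e2]
    ring

lemma ecoef_succ (α : ℝ) (hα : 0 < α) (l j k : ℕ) (h : 2 * (k + (j + 1)) ≤ l) :
    ecoef α l (j + 1) k * (4 * ((j : ℝ) + 1) * (α + l - 2 * k - (j + 1))) = - ecoef α l j k := by
  unfold ecoef
  have hl : (2 * (k + (j + 1)) : ℝ) ≤ l := by exact_mod_cast h
  have hj : (0 : ℝ) ≤ j := Nat.cast_nonneg _
  have hk : (0 : ℝ) ≤ k := Nat.cast_nonneg _
  have e : Real.Gamma (α + l - 2 * k - j) =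
      (α + l - 2 * k - (j + 1)) * Real.Gamma (α + l - 2 * k - (j + 1)) := by
    rw [← Real.Gamma_add_one (by nlinarith)]; congr 1; ring
  have hG : Real.Gamma (α + l + 1 - k) ≠ 0 := (Real.Gamma_pos_of_pos (by nlinarith)).ne'
  rw [e]
  push_cast [Nat.factorial_succ]
  have := Nat.factorial_pos j
  have := Nat.factorial_pos k
  field_simp
  ring

lemma harmComp_homog {d l k : ℕ} (α : ℝ) {P : MvPolynomial (Fin d) ℝ} (hP : P.IsHomogeneous l)
    (hk : k ≤ l / 2) : (harmComp d α l k P).IsHomogeneous (l - 2 * k) := by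
  unfold harmComp
  apply IsHomogeneous.sum
  intro j hj
  rw [Finset.mem_range] at hj
  have h1 := ((isHomogeneous_C (Fin d) (ecoef α l j k)).mul ((r2_homog d).pow j)).mul
    (lap_iter_homog hP (k + j))
  have : 0 + 2 * j + (l - 2 * (k + j)) = l - 2 * k := by omega
  rwa [this] at h1

lemma harmComp_harmonic {d l k : ℕ} (hd : 3 ≤ d) (α : ℝ) (hα : α = ((d : ℝ) - 2) / 2)
    {P : MvPolynomial (Fin d) ℝ} (hP : P.IsHomogeneous l)
    (hk : k ≤ l / 2) : lap (harmComp d α l k P) = 0 := by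
  have hα0 : 0 < α := by
    have : (3 : ℝ) ≤ d := by exact_mod_cast hd
    rw [hα]; linarith
  unfold harmComp
  rw [lap_sum']
  have key : ∀ n, n ≤ l / 2 - k → ∑ j ∈ Finset.range (n + 1),
      lap (C (ecoef α l j k) * (r2 d) ^ j * lap^[k + j] P) =
      C (ecoef α l n k) * (r2 d) ^ n * lap^[k + n + 1] P := by
    intro n
    induction n with
    | zero =>
      intro _
      simp [lap_C_mul', Function.iterate_succ_apply']
    | succ n ih =>
      intro hn
      rw [Finset.sum_range_succ, ih (by omega), mul_assoc, mul_assoc, lap_C_mul',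
        lap_r2_pow_mul (lap_iter_homog hP (k + (n + 1))) n,
        ← Function.iterate_succ_apply' lap, mul_add, ← mul_assoc (C _) (C _), ← C_mul]
      have e : α + ((n : ℝ) + 1) + ((l - 2 * (k + (n + 1)) : ℕ) : ℝ) = α + l - 2 * k - (n + 1) := by
        rw [Nat.cast_sub (by omega)]; push_cast; ring
      rw [← hα, e, ecoef_succ α hα0 l n k (by omega), C_neg]
      have e3 : k + n + 1 = k + (n + 1) := by ring
      rw [e3]
      ring
  rw [key _ le_rfl]
  have e : k + (l / 2 - k) + 1 = l / 2 + 1 := by omega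
  rw [e, Function.iterate_succ_apply', lap_homog_le_one (lap_iter_homog hP (l / 2)) (by omega)]
  simp

lemma ecoef_partial (α : ℝ) (hα : 0 < α) (l n : ℕ) (h : 2 * (n + 1) ≤ l) (K : ℕ) (hK : K ≤ n + 1) :
    ∑ k ∈ Finset.range (K + 1), ecoef α l (n + 1 - k) k =
      (-1) ^ (n + 1 + K) * (n.choose K) * Real.Gamma (α + l - K - (n + 1)) /
        (4 ^ (n + 1) * ((n + 1).factorial) * Real.Gamma (α + l - K)) := by
  have hl : (2 * (n + 1) : ℝ) ≤ l := by exact_mod_cast h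
  have hn : (0 : ℝ) ≤ n := Nat.cast_nonneg _
  induction K with
  | zero =>
    simp only [zero_add, Finset.sum_range_one, Nat.sub_zero, ecoef]
    have e : Real.Gamma (α + l + 1 - (0 : ℕ)) = (α + l) * Real.Gamma (α + l) := by
      rw [← Real.Gamma_add_one (by nlinarith)]; simp
    rw [e]
    have : α + l ≠ 0 := by nlinarith
    have : Real.Gamma (α + l) ≠ 0 := (Real.Gamma_pos_of_pos (by nlinarith)).ne'
    push_cast
    simp
    field_simp
  | succ K ih =>
    rw [Finset.sum_range_succ, ih (by omega)]
    have hK' : (K : ℝ) ≤ n := by exact_mod_cast (by omega : K ≤ n)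
    set a := α + l with ha
    set X := Real.Gamma (a - (K + 1) - (n + 1)) with hX
    set Y := Real.Gamma (a - (K + 1)) with hY
    have hY0 : Y ≠ 0 := (Real.Gamma_pos_of_pos (by nlinarith)).ne'
    have ha0 : a - (K + 1) ≠ 0 := by nlinarith
    have e1 : Real.Gamma (a - K - (n + 1)) = (a - (K + 1) - (n + 1)) * X := by
      rw [hX, ← Real.Gamma_add_one (by nlinarith)]; congr 1; ring
    have e2 : Real.Gamma (a - K) = (a - (K + 1)) * Y := by
      rw [hY, ← Real.Gamma_add_one ha0]; congr 1; ring
    have c1 : ((n + 1).factorial : ℝ) =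
      ((n + 1).choose (K + 1)) * (K + 1).factorial * ((n + 1 - (K + 1)).factorial) := by
      exact_mod_cast (Nat.choose_mul_factorial_mul_factorial hK).symm
    have c2 : ((n + 1).choose (K + 1) : ℝ) = n.choose K + n.choose (K + 1) := by
      exact_mod_cast Nat.choose_succ_succ n K
    have c3 : ((n : ℝ) + 1) * n.choose K = (n + 1).choose (K + 1) * (K + 1) := by
      exact_mod_cast Nat.add_one_mul_choose_eq n K
    have e3 : ecoef α l (n + 1 - (K + 1)) (K + 1) =
        (-1) ^ (n + 1 + (K + 1)) * (a - 2 * (K + 1)) * X * ((n + 1).choose (K + 1)) /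
        (4 ^ (n + 1) * ((n + 1).factorial) * ((a - (K + 1)) * Y)) := by
      unfold ecoef
      have h1 : ((n + 1 - (K + 1) : ℕ) : ℝ) = n - K := by
        rw [Nat.cast_sub hK]; push_cast; ring
      have h2 : (-1 : ℝ) ^ (n + 1 - (K + 1)) = (-1) ^ (n + 1 + (K + 1)) := by
        have : n + 1 + (K + 1) = (n + 1 - (K + 1)) + 2 * (K + 1) := by omega
        rw [this, pow_add, pow_mul]; simp
      have h3 : K + 1 + (n + 1 - (K + 1)) = n + 1 := by omega
      rw [h3, h2, c1, h1]
      have h4 : Real.Gamma (α + l + 1 - (K + 1 : ℕ)) = (a - (K + 1)) * Y := by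
        rw [← e2]; congr 1; push_cast; ring
      have h5 : Real.Gamma (α + l - 2 * (K + 1 : ℕ) - (n - K)) = X := by
        rw [hX]; congr 1; push_cast; ring
      rw [h4, h5]
      have := (Nat.choose_pos hK)
      have := Nat.factorial_pos (K + 1)
      have := Nat.factorial_pos (n + 1 - (K + 1))
      push_cast
      field_simp
      rw [ha]; ring
    rw [e1, e2, e3]
    push_cast
    rw [← hX, ← hY, c2]
    rw [c2] at c3
    have := Nat.factorial_pos (n + 1)
    have hp : (-1 : ℝ) ^ (n + 1 + (K + 1)) = - (-1) ^ (n + 1 + K) := by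
      rw [← add_assoc, pow_succ]; ring
    rw [hp]
    field_simp
    linear_combination (-X) * c3

lemma decomp {d l : ℕ} (hd : 3 ≤ d) (α : ℝ) (hα : α = ((d : ℝ) - 2) / 2)
    {P : MvPolynomial (Fin d) ℝ} :
    ∑ k ∈ Finset.range (l / 2 + 1), r2 d ^ k * harmComp d α l k P = P := by
  have hα0 : 0 < α := by
    have : (3 : ℝ) ≤ d := by exact_mod_cast hd
    rw [hα]; linarith
  have h1 : ∀ k ∈ Finset.range (l / 2 + 1), r2 d ^ k * harmComp d α l k P =
      ∑ j ∈ Finset.range (l / 2 + 1 - k), C (ecoef α l (k + j - k) k) * (r2 d ^ (k + j) * lap^[k + j] P) := by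
    intro k hk
    rw [Finset.mem_range] at hk
    unfold harmComp
    rw [Finset.mul_sum, show l / 2 + 1 - k = l / 2 - k + 1 by omega]
    apply Finset.sum_congr rfl
    intro j _
    rw [Nat.add_sub_cancel_left]
    ring
  rw [Finset.sum_congr rfl h1]
  rw [← Finset.sum_range_diag_flip (l / 2 + 1)
    (fun k j => C (ecoef α l (k + j - k) k) * (r2 d ^ (k + j) * lap^[k + j] P))]
  have h2 : ∀ m ∈ Finset.range (l / 2 + 1), ∑ k ∈ Finset.range (m + 1),
      C (ecoef α l (k + (m - k) - k) k) * (r2 d ^ (k + (m - k)) * lap^[k + (m - k)] P) =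
      if m = 0 then P else 0 := by
    intro m hm
    rw [Finset.mem_range] at hm
    have h3 : ∀ k ∈ Finset.range (m + 1),
      C (ecoef α l (k + (m - k) - k) k) * (r2 d ^ (k + (m - k)) * lap^[k + (m - k)] P) =
      C (ecoef α l (m - k) k) * (r2 d ^ m * lap^[m] P) := by
      intro k hk
      rw [Finset.mem_range] at hk
      rw [show k + (m - k) = m by omega]
    rw [Finset.sum_congr rfl h3, ← Finset.sum_mul, ← map_sum]
    rcases m with _ | n
    · have hl : (0 : ℝ) ≤ l := Nat.cast_nonneg _
      have h5 : Real.Gamma (α + l) ≠ 0 := (Real.Gamma_pos_of_pos (by linarith)).ne'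
      have h6 : α + l ≠ 0 := by linarith
      have h4 : ecoef α l 0 0 = 1 := by
        unfold ecoef
        simp [Real.Gamma_add_one h6, h5, h6]
      simp [h4]
    · rw [ecoef_partial α hα0 l n (by omega) (n + 1) le_rfl]
      simp
  rw [Finset.sum_congr rfl h2]
  simp

lemma poly_bound {d : ℕ} (Q : MvPolynomial (Fin d) ℝ) :
    ∃ (c : ℝ) (N : ℕ), 0 ≤ c ∧ ∀ x : EuclideanSpace ℝ (Fin d),
      |eval (fun i => x i) Q| ≤ c * (1 + ‖x‖) ^ N := by
  induction Q using MvPolynomial.induction_on with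
  | C a => exact ⟨|a|, 0, abs_nonneg _, fun x => by simp⟩
  | add p q hp hq =>
    obtain ⟨c1, N1, h1, H1⟩ := hp
    obtain ⟨c2, N2, h2, H2⟩ := hq
    refine ⟨c1 + c2, max N1 N2, by positivity, fun x => ?_⟩
    rw [map_add]
    have hx : 1 ≤ 1 + ‖x‖ := by linarith [norm_nonneg x]
    calc _ ≤ |eval (fun i => x i) p| + |eval (fun i => x i) q| := abs_add_le _ _
      _ ≤ c1 * (1 + ‖x‖) ^ N1 + c2 * (1 + ‖x‖) ^ N2 := add_le_add (H1 x) (H2 x)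
      _ ≤ c1 * (1 + ‖x‖) ^ (max N1 N2) + c2 * (1 + ‖x‖) ^ (max N1 N2) := by
        gcongr
        · exact le_max_left _ _
        · exact le_max_right _ _
      _ = _ := by ring
  | mul_X p n hp =>
    obtain ⟨c1, N1, h1, H1⟩ := hp
    refine ⟨c1, N1 + 1, h1, fun x => ?_⟩
    rw [map_mul, eval_X, abs_mul, pow_succ, ← mul_assoc]
    have hx : |x n| ≤ ‖x‖ := PiLp.norm_apply_le x n
    have := norm_nonneg x
    gcongr
    · exact H1 x
    · linarith

lemma continuous_evalE {d : ℕ} (Q : MvPolynomial (Fin d) ℝ) :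
    Continuous (fun x : EuclideanSpace ℝ (Fin d) => eval (fun i => x i) Q) := by
  have h := MvPolynomial.continuous_eval Q
  exact h.comp (by fun_prop)

def Decay (g : ℝ → ℝ) : Prop :=
  Continuous g ∧ ∀ N : ℕ, ∃ c, ∀ s, 0 ≤ s → (1 + s) ^ N * |g s| ≤ c

lemma integrable_decay {d : ℕ} {g : ℝ → ℝ} (hg : Decay g) (Q : MvPolynomial (Fin d) ℝ) :
    Integrable (fun x : EuclideanSpace ℝ (Fin d) => g ‖x‖ * eval (fun i => x i) Q) := by
  obtain ⟨hc, hg⟩ := hg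
  obtain ⟨c, N, c0, H⟩ := poly_bound Q
  obtain ⟨c', H'⟩ := hg (N + (d + 1))
  have h1 : Integrable (fun x : EuclideanSpace ℝ (Fin d) => (c * c') * (1 + ‖x‖) ^ (-((d : ℝ) + 1))) := by
    apply Integrable.const_mul
    apply integrable_one_add_norm
    simp
  refine h1.mono' ((hc.comp continuous_norm).mul (continuous_evalE Q)).aestronglyMeasurable ?_
  filter_upwards with x
  have hx0 := norm_nonneg x
  have hx : 0 < 1 + ‖x‖ := by linarith
  rw [Real.rpow_neg hx.le, norm_mul, Real.norm_eq_abs, Real.norm_eq_abs]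
  have e : (1 + ‖x‖) ^ ((d : ℝ) + 1) = (1 + ‖x‖) ^ (d + 1) := by
    rw [← Real.rpow_natCast]; push_cast; rfl
  rw [e, ← div_eq_mul_inv, le_div_iff₀ (by positivity)]
  calc |g ‖x‖| * |eval (fun i => x i) Q| * (1 + ‖x‖) ^ (d + 1)
      ≤ |g ‖x‖| * (c * (1 + ‖x‖) ^ N) * (1 + ‖x‖) ^ (d + 1) := by gcongr; exact H x
    _ = c * ((1 + ‖x‖) ^ (N + (d + 1)) * |g ‖x‖|) := by rw [pow_add]; ring
    _ ≤ c * c' := by gcongr; exact H' _ hx0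

lemma decay_gauss : Decay (fun s => Real.exp (-s ^ 2 / 2)) := by
  refine ⟨by fun_prop, fun N => ⟨N.factorial * Real.exp (3 / 2), fun s hs => ?_⟩⟩
  rw [Real.abs_exp]
  have h1 := Real.pow_div_factorial_le_exp (1 + s) (by linarith) N
  rw [div_le_iff₀ (by positivity)] at h1
  calc (1 + s) ^ N * Real.exp (-s ^ 2 / 2) ≤
      (Real.exp (1 + s) * N.factorial) * Real.exp (-s ^ 2 / 2) := by gcongr
    _ = N.factorial * Real.exp (1 + s + -s ^ 2 / 2) := by rw [Real.exp_add (1 + s)]; ring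
    _ ≤ _ := by
      gcongr
      nlinarith [sq_nonneg (s - 1)]

lemma decay_schwartz (f : 𝓢(ℝ, ℝ)) (k : ℕ) : Decay (fun s => s ^ (2 * k) * f s) := by
  refine ⟨(continuous_pow _).mul f.continuous, fun N => ?_⟩
  obtain ⟨c0, -, h0⟩ := f.decay 0 0
  obtain ⟨c1, -, h1⟩ := f.decay (N + 2 * k) 0
  refine ⟨2 ^ (N + 2 * k - 1) * (c0 + c1), fun s hs => ?_⟩
  have h0 := h0 s
  have h1 := h1 s
  simp only [norm_iteratedFDeriv_zero, pow_zero, one_mul, Real.norm_eq_abs, abs_of_nonneg hs]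
    at h0 h1
  have h2 := add_pow_le (zero_le_one' ℝ) hs (N + 2 * k)
  rw [one_pow] at h2
  rw [abs_mul, abs_of_nonneg (by positivity : 0 ≤ s ^ (2 * k))]
  have h3 : s ^ (2 * k) ≤ (1 + s) ^ (2 * k) := by gcongr; linarith
  calc (1 + s) ^ N * (s ^ (2 * k) * |f s|) ≤ (1 + s) ^ N * ((1 + s) ^ (2 * k) * |f s|) := by gcongr
    _ = (1 + s) ^ (N + 2 * k) * |f s| := by rw [pow_add]; ring
    _ ≤ (2 ^ (N + 2 * k - 1) * (1 + s ^ (N + 2 * k))) * |f s| := by gcongr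
    _ = 2 ^ (N + 2 * k - 1) * (|f s| + s ^ (N + 2 * k) * |f s|) := by ring
    _ ≤ _ := by gcongr

def GI {d : ℕ} (Q : MvPolynomial (Fin d) ℝ) : ℝ :=
  ∫ x : EuclideanSpace ℝ (Fin d), Real.exp (-‖x‖ ^ 2 / 2) * eval (fun i => x i) Q

lemma GI_add {d : ℕ} (P Q : MvPolynomial (Fin d) ℝ) : GI (P + Q) = GI P + GI Q := by
  unfold GI
  rw [← integral_add (integrable_decay decay_gauss P) (integrable_decay decay_gauss Q)]
  simp [mul_add]

lemma GI_C_mul {d : ℕ} (c : ℝ) (Q : MvPolynomial (Fin d) ℝ) : GI (C c * Q) = c * GI Q := by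
  unfold GI
  rw [← integral_const_mul]
  congr 1; ext x; simp; ring

lemma GI_sum {d : ℕ} {ι : Type*} (s : Finset ι) (Q : ι → MvPolynomial (Fin d) ℝ) :
    GI (∑ i ∈ s, Q i) = ∑ i ∈ s, GI (Q i) := by
  classical
  induction s using Finset.induction_on with
  | empty => simp [GI]
  | insert a s ha ih => rw [Finset.sum_insert ha, Finset.sum_insert ha, GI_add, ih]

lemma hasLineDerivAt_eval {d : ℕ} (Q : MvPolynomial (Fin d) ℝ) (i : Fin d)
    (x : EuclideanSpace ℝ (Fin d)) :
    HasLineDerivAt ℝ (fun x : EuclideanSpace ℝ (Fin d) => eval (fun i => x i) Q)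
      (eval (fun i => x i) (pderiv i Q)) x (EuclideanSpace.single i 1) := by
  unfold HasLineDerivAt
  induction Q using MvPolynomial.induction_on with
  | C a => simpa using hasDerivAt_const (0 : ℝ) a
  | add p q hp hq => simpa only [map_add] using hp.fun_add hq
  | mul_X p n hp =>
    have h1 : HasDerivAt (fun t : ℝ => eval (fun i' => (x + t • EuclideanSpace.single i (1 : ℝ)) i') (X n))
        (eval (fun i => x i) (pderiv i (X n))) 0 := by
      by_cases h : n = i
      · subst h
        simpa using (hasDerivAt_id (0 : ℝ)).const_add (x n)
      · rw [pderiv_X_of_ne h]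
        simpa [h] using hasDerivAt_const (0 : ℝ) (x n)
    have := hp.mul h1
    simp only [pderiv_mul, map_mul, map_add]
    convert! this using 1
    simp

lemma GI_ibp {d : ℕ} (Q : MvPolynomial (Fin d) ℝ) (i : Fin d) :
    GI (X i * Q) = GI (pderiv i Q) := by
  have hg : ∀ x : EuclideanSpace ℝ (Fin d),
      HasLineDerivAt ℝ (fun x : EuclideanSpace ℝ (Fin d) => Real.exp (-‖x‖ ^ 2 / 2))
      (-(Real.exp (-‖x‖ ^ 2 / 2) * x i)) x (EuclideanSpace.single i 1) := by
    intro x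
    have h1 : HasFDerivAt (fun x : EuclideanSpace ℝ (Fin d) => ‖x‖ ^ 2) (2 • innerSL ℝ x) x :=
      (hasStrictFDerivAt_norm_sq x).hasFDerivAt
    have h2 := ((h1.neg.mul_const (1 / 2)).exp).hasLineDerivAt (EuclideanSpace.single i 1)
    convert! h2 using 1
    · ext x; simp; ring_nf
    · simp; ring_nf
      simp [EuclideanSpace.inner_single_right]
  have := integral_bilinear_hasLineDerivAt_right_eq_neg_left_of_integrable (μ := volume)
    (f := fun x : EuclideanSpace ℝ (Fin d) => Real.exp (-‖x‖ ^ 2 / 2))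
    (f' := fun x => (-(Real.exp (-‖x‖ ^ 2 / 2) * x i)))
    (g := fun x : EuclideanSpace ℝ (Fin d) => eval (fun i => x i) Q)
    (g' := fun x : EuclideanSpace ℝ (Fin d) => eval (fun i => x i) (pderiv i Q))
    (v := EuclideanSpace.single i 1) (B := ContinuousLinearMap.mul ℝ ℝ)
    (by
      have := (integrable_decay decay_gauss (X i * Q)).neg
      refine this.congr (Filter.Eventually.of_forall fun x => ?_)
      simp; ring)
    (integrable_decay decay_gauss (pderiv i Q))
    (integrable_decay decay_gauss Q)
    (fun x _ => hg x) (fun x _ => hasLineDerivAt_eval Q i x)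
  unfold GI
  simp only [ContinuousLinearMap.mul_apply'] at this
  rw [this, ← integral_neg]
  congr 1; ext x; simp; ring

lemma GI_one (d : ℕ) : GI (1 : MvPolynomial (Fin d) ℝ) = (2 * Real.pi) ^ ((d : ℝ) / 2) := by
  unfold GI
  have := GaussianFourier.integral_rexp_neg_mul_sq_norm (V := EuclideanSpace ℝ (Fin d)) (b := 1 / 2) (by norm_num)
  rw [finrank_euclideanSpace_fin] at this
  rw [show Real.pi / (1 / 2) = 2 * Real.pi by ring] at this
  rw [← this]
  congr 1; ext x; simp; ring

def Ly {d : ℕ} (y : EuclideanSpace ℝ (Fin d)) : MvPolynomial (Fin d) ℝ := ∑ i, C (y i) * X i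

def Dy {d : ℕ} (y : EuclideanSpace ℝ (Fin d)) (P : MvPolynomial (Fin d) ℝ) :
    MvPolynomial (Fin d) ℝ := ∑ i, C (y i) * pderiv i P

lemma eval_Ly {d : ℕ} (y x : EuclideanSpace ℝ (Fin d)) : eval (fun i => x i) (Ly y) = ⟪y, x⟫ := by
  simp [Ly, PiLp.inner_apply, mul_comm]

lemma Ly_homog {d : ℕ} (y : EuclideanSpace ℝ (Fin d)) : (Ly y).IsHomogeneous 1 := by
  unfold Ly
  apply IsHomogeneous.sum
  intro i _
  simpa using (isHomogeneous_C (Fin d) (y i)).mul (isHomogeneous_X ℝ i)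

lemma GI_Ly_mul {d : ℕ} (y : EuclideanSpace ℝ (Fin d)) (Q : MvPolynomial (Fin d) ℝ) :
    GI (Ly y * Q) = GI (Dy y Q) := by
  unfold Ly Dy
  rw [Finset.sum_mul, GI_sum, GI_sum]
  apply Finset.sum_congr rfl
  intro i _
  rw [mul_assoc, GI_C_mul, GI_C_mul, GI_ibp]

lemma pderiv_Ly {d : ℕ} (y : EuclideanSpace ℝ (Fin d)) (i : Fin d) :
    pderiv i (Ly y) = C (y i) := by
  classical
  unfold Ly
  rw [map_sum, Finset.sum_eq_single i]
  · simp
  · intro j _ hj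
    rw [pderiv_C_mul, pderiv_X_of_ne hj]; simp
  · simp

lemma Dy_mul {d : ℕ} (y : EuclideanSpace ℝ (Fin d)) (P : MvPolynomial (Fin d) ℝ) (n : ℕ) :
    Dy y (P * Ly y ^ n) = Dy y P * Ly y ^ n + C (n * ‖y‖ ^ 2) * (P * Ly y ^ (n - 1)) := by
  have h : (C (‖y‖ ^ 2) : MvPolynomial (Fin d) ℝ) = ∑ i, C (y i) * C (y i) := by
    simp_rw [← C_mul, ← map_sum]
    rw [EuclideanSpace.norm_sq_eq]
    simp [pow_two]
  rw [C_mul, h]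
  unfold Dy
  rw [Finset.sum_mul, Finset.mul_sum, Finset.sum_mul, ← Finset.sum_add_distrib]
  apply Finset.sum_congr rfl
  intro i _
  rw [pderiv_mul, pderiv_pow, pderiv_Ly]
  simp
  ring

lemma Dy_homog {d : ℕ} (y : EuclideanSpace ℝ (Fin d)) {P : MvPolynomial (Fin d) ℝ} {n : ℕ}
    (h : P.IsHomogeneous n) : (Dy y P).IsHomogeneous (n - 1) := by
  unfold Dy
  apply IsHomogeneous.sum
  intro i _
  simpa using (isHomogeneous_C (Fin d) (y i)).mul (h.pderiv (i := i))

lemma pderiv_comm' {d : ℕ} (i j : Fin d) (P : MvPolynomial (Fin d) ℝ) :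
    pderiv i (pderiv j P) = pderiv j (pderiv i P) := by
  have h : ⁅(pderiv i : Derivation ℝ (MvPolynomial (Fin d) ℝ) (MvPolynomial (Fin d) ℝ)),
      (pderiv j : Derivation ℝ (MvPolynomial (Fin d) ℝ) (MvPolynomial (Fin d) ℝ))⁆ = 0 := by
    classical
    apply MvPolynomial.derivation_ext
    intro k
    simp [Derivation.commutator_apply, pderiv_X, Pi.single_apply, apply_ite]
  have h2 := congrArg (fun D => D P) h
  simp only [Derivation.commutator_apply, Derivation.zero_apply] at h2
  exact sub_eq_zero.1 h2

lemma lap_Dy {d : ℕ} (y : EuclideanSpace ℝ (Fin d)) {P : MvPolynomial (Fin d) ℝ}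
    (h : lap P = 0) : lap (Dy y P) = 0 := by
  have h1 : ∀ i, lap (pderiv i P) = pderiv i (lap P) := by
    intro i
    unfold lap
    rw [map_sum]
    apply Finset.sum_congr rfl
    intro j _
    rw [pderiv_comm' j i, pderiv_comm' j i]
  unfold Dy
  rw [lap_sum']
  simp [lap_C_mul', h1, h]

lemma eval_Dy {d : ℕ} (y : EuclideanSpace ℝ (Fin d)) {P : MvPolynomial (Fin d) ℝ} {n : ℕ}
    (h : P.IsHomogeneous n) : eval (fun i => y i) (Dy y P) = n * eval (fun i => y i) P := by
  have := congrArg (eval (fun i => y i)) h.sum_X_mul_pderiv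
  simpa [Dy] using this

lemma GI_homog {d : ℕ} {P : MvPolynomial (Fin d) ℝ} {n : ℕ} (h : P.IsHomogeneous n) :
    n * GI P = GI (lap P) := by
  have h1 : (C (n : ℝ)) * P = n • P := by simp
  rw [← GI_C_mul, h1, ← h.sum_X_mul_pderiv, GI_sum]
  unfold lap
  rw [GI_sum]
  simp [GI_ibp]

lemma GI_moment {d : ℕ} (y : EuclideanSpace ℝ (Fin d)) (n : ℕ) :
    ∀ (l : ℕ) (P : MvPolynomial (Fin d) ℝ), P.IsHomogeneous l → lap P = 0 →
    (∀ m, n = l + 2 * m → GI (P * Ly y ^ n) =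
      n.factorial / (2 ^ m * m.factorial) * (‖y‖ ^ (2 * m) * eval (fun i => y i) P * GI (1 : MvPolynomial (Fin d) ℝ))) ∧
    ((∀ m, n ≠ l + 2 * m) → GI (P * Ly y ^ n) = 0) := by
  induction n using Nat.strong_induction_on with
  | _ n ih =>
  intro l P hP hl
  rcases n with _ | n
  · rcases Nat.eq_zero_or_pos l with h0 | h0
    · subst h0
      refine ⟨fun m hm => ?_, fun h => absurd rfl (h 0)⟩
      obtain rfl : m = 0 := by omega
      rw [← totalDegree_zero_iff_isHomogeneous, totalDegree_eq_zero_iff_eq_C] at hP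
      rw [hP, GI_C_mul]
      simp
    · refine ⟨fun m hm => by omega, fun h => ?_⟩
      have := GI_homog hP
      rw [hl] at this
      have hz : GI (0 : MvPolynomial (Fin d) ℝ) = 0 := by simp [GI]
      rw [hz] at this
      have hl0 : (l : ℝ) ≠ 0 := by positivity
      simpa [hl0] using this
  · have hrec : GI (P * Ly y ^ (n + 1)) = GI (Dy y P * Ly y ^ n) +
        (n * ‖y‖ ^ 2) * GI (P * Ly y ^ (n - 1)) := by
      rw [← GI_C_mul, ← GI_add, ← Dy_mul, ← GI_Ly_mul]
      congr 1; ring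
    rw [hrec]
    set G1 := GI (1 : MvPolynomial (Fin d) ℝ)
    have hD0 : l = 0 → Dy y P = 0 := by
      rintro rfl
      simp [Dy, pderiv_homog_zero hP]
    have hz : GI (0 : MvPolynomial (Fin d) ℝ) = 0 := by simp [GI]
    obtain ⟨i1, i2⟩ := ih n (by omega) (l - 1) (Dy y P) (Dy_homog y hP) (lap_Dy y hl)
    obtain ⟨j1, j2⟩ := ih (n - 1) (by omega) l P hP hl
    refine ⟨fun m hm => ?_, fun h => ?_⟩
    · have t1 : GI (Dy y P * Ly y ^ n) =
        n.factorial / (2 ^ m * m.factorial) * (‖y‖ ^ (2 * m) * (l * eval (fun i => y i) P) * G1) := by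
        rcases Nat.eq_zero_or_pos l with h0 | h0
        · rw [hD0 h0, h0]; simp [hz]
        · rw [i1 m (by omega), eval_Dy y hP]
      have t2 : n * ‖y‖ ^ 2 * GI (P * Ly y ^ (n - 1)) =
        n.factorial / (2 ^ m * m.factorial) * (‖y‖ ^ (2 * m) * ((2 * m) * eval (fun i => y i) P) * G1) := by
        rcases m with _ | m
        · rcases n with _ | n
          · simp
          · rw [j2 (fun m => by omega)]; simp
        · obtain ⟨n, rfl⟩ : ∃ n', n = n' + 1 := ⟨n - 1, by omega⟩
          rw [j1 m (by omega)]
          simp only [Nat.add_sub_cancel]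
          push_cast [Nat.factorial_succ]
          have := Nat.factorial_pos m
          field_simp
          ring
      rw [t1, t2]
      have e : ((n + 1).factorial : ℝ) = (l + 2 * m) * n.factorial := by
        rw [Nat.factorial_succ, hm]; push_cast; ring
      rw [e]
      ring
    · have t1 : GI (Dy y P * Ly y ^ n) = 0 := by
        rcases Nat.eq_zero_or_pos l with h0 | h0
        · rw [hD0 h0]; simp [hz]
        · exact i2 (fun m hm => h m (by omega))
      have t2 : n * ‖y‖ ^ 2 * GI (P * Ly y ^ (n - 1)) = 0 := by
        rcases n with _ | n
        · simp
        · rw [j2 (fun m hm => h (m + 1) (by simp at hm; omega))]; simp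
      rw [t1, t2]; simp

open MeasureTheory.Measure in
lemma polar {d : ℕ} (hd : 3 ≤ d) {F : EuclideanSpace ℝ (Fin d) → ℂ} (hF : Integrable F) :
    ∫ x, F x = ∫ s in Set.Ioi (0 : ℝ), ((s ^ (d - 1) : ℝ) : ℂ) *
      ∫ w : Metric.sphere (0 : EuclideanSpace ℝ (Fin d)) 1, F (s • (w : EuclideanSpace ℝ (Fin d)))
        ∂(volume.toSphere) := by
  let E := EuclideanSpace ℝ (Fin d)
  have hfr : Module.finrank ℝ E = d := by simp [E]
  have hn : Nontrivial E := Module.nontrivial_of_finrank_pos (R := ℝ) (by omega)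
  have mp := (volume : Measure E).measurePreserving_homeomorphUnitSphereProd
  rw [hfr] at mp
  let H : Metric.sphere (0 : E) 1 × Set.Ioi (0 : ℝ) → ℂ := fun p => F ((p.2 : ℝ) • (p.1 : E))
  have hH : ∀ x : ({(0)}ᶜ : Set E), H (homeomorphUnitSphereProd E x) = F x := by
    intro x
    have : ((homeomorphUnitSphereProd E).symm (homeomorphUnitSphereProd E x) : E) = x := by
      rw [Homeomorph.symm_apply_apply]
    rw [homeomorphUnitSphereProd_symm_apply_coe] at this
    simp only [H]
    rw [this]
  have e1 : ∫ x, F x = ∫ x : ({(0)}ᶜ : Set E), F x ∂(volume.comap Subtype.val) := by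
    rw [integral_subtype_comap (measurableSet_singleton _).compl fun x ↦ F x,
        restrict_compl_singleton]
  have i1 : Integrable (fun x : ({(0)}ᶜ : Set E) => F x) (volume.comap Subtype.val) := by
    have : IntegrableOn F ({0}ᶜ : Set E) := hF.integrableOn
    rwa [integrableOn_iff_comap_subtypeVal (measurableSet_singleton _).compl] at this
  simp_rw [← hH] at e1 i1
  have i2 : Integrable H (volume.toSphere.prod (volumeIoiPow (d - 1))) :=
    (mp.integrable_comp_emb (Homeomorph.measurableEmbedding _)).1 i1
  rw [e1, mp.integral_comp (Homeomorph.measurableEmbedding _) H, integral_prod_symm _ i2]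
  simp only [volumeIoiPow, ENNReal.ofReal]
  rw [integral_withDensity_eq_integral_smul]
  · have e3 := integral_subtype_comap (μ := volume) (measurableSet_Ioi (a := (0 : ℝ)))
      (fun a : ℝ ↦ Real.toNNReal (a ^ (d - 1)) •
        ∫ w : Metric.sphere (0 : E) 1, F (a • (w : E)) ∂(volume.toSphere))
    refine Eq.trans e3 ?_
    apply setIntegral_congr_fun measurableSet_Ioi
    intro x hx
    simp only
    rw [NNReal.smul_def, Real.coe_toNNReal _ (pow_nonneg (Set.mem_Ioi.1 hx).le _)]
    simp
  · exact (measurable_subtype_coe.pow_const _).real_toNNReal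

lemma eval_smul_homog {d q : ℕ} {Q : MvPolynomial (Fin d) ℝ} (h : Q.IsHomogeneous q) (s : ℝ)
    (x : EuclideanSpace ℝ (Fin d)) :
    eval (fun i => (s • x) i) Q = s ^ q * eval (fun i => x i) Q := by
  rw [eval_eq, eval_eq, Finset.mul_sum]
  apply Finset.sum_congr rfl
  intro m hm
  have h1 := h (mem_support_iff.1 hm)
  simp only [PiLp.smul_apply, smul_eq_mul, mul_pow, Finset.prod_mul_distrib, Finset.prod_pow_eq_pow_sum]
  have h2 : ∑ i ∈ m.support, m i = q := by
    rw [← h1]; simp [Finsupp.weight_apply, Finsupp.sum]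
  rw [h2]; ring

def SI {d : ℕ} (Q : MvPolynomial (Fin d) ℝ) : ℝ :=
  ∫ w : Metric.sphere (0 : EuclideanSpace ℝ (Fin d)) 1,
    eval (fun i => (w : EuclideanSpace ℝ (Fin d)) i) Q ∂((volume : Measure (EuclideanSpace ℝ (Fin d))).toSphere)

lemma GI_eq_SI {d q : ℕ} (hd : 3 ≤ d) {Q : MvPolynomial (Fin d) ℝ} (h : Q.IsHomogeneous q) :
    GI Q = SI Q * ((1 / 2 : ℝ) ^ (-((q : ℝ) + d) / 2) * (1 / 2) * Real.Gamma (((q : ℝ) + d) / 2)) := by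
  have hi := (integrable_decay decay_gauss Q).ofReal (𝕜 := ℂ)
  have h1 := polar hd hi
  have h2 : ((GI Q : ℝ) : ℂ) = ∫ x : EuclideanSpace ℝ (Fin d),
      ((Real.exp (-‖x‖ ^ 2 / 2) * eval (fun i => x i) Q : ℝ) : ℂ) := by
    rw [integral_complex_ofReal]; rfl
  have hd1 : (1 : ℝ) ≤ d := by exact_mod_cast (by omega : 1 ≤ d)
  have hq : (0 : ℝ) ≤ q := Nat.cast_nonneg _
  have h3 := integral_rpow_mul_exp_neg_mul_rpow (p := 2) (q := (q : ℝ) + d - 1) (b := 1 / 2)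
    (by norm_num) (by linarith) (by norm_num)
  rw [show (q : ℝ) + d - 1 + 1 = q + d by ring] at h3
  rw [← h3, ← integral_const_mul]
  apply Complex.ofReal_injective
  rw [h2, ← integral_complex_ofReal]
  refine h1.trans ?_
  apply setIntegral_congr_fun measurableSet_Ioi
  intro s hs
  have hs0 : 0 < s := hs
  simp only
  have h4 : ∀ w : Metric.sphere (0 : EuclideanSpace ℝ (Fin d)) 1,
      (((Real.exp (-‖s • (w : EuclideanSpace ℝ (Fin d))‖ ^ 2 / 2) *
        eval (fun i => (s • (w : EuclideanSpace ℝ (Fin d))) i) Q : ℝ)) : ℂ) =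
      ((Real.exp (-s ^ 2 / 2) * s ^ q * eval (fun i => (w : EuclideanSpace ℝ (Fin d)) i) Q : ℝ) : ℂ) := by
    intro w
    rw [eval_smul_homog h, norm_smul]
    simp [abs_of_pos hs0]
    ring
  have h5 : s ^ ((q : ℝ) + d - 1) = s ^ q * s ^ (d - 1) := by
    rw [← pow_add, ← Real.rpow_natCast]
    congr 1
    rw [Nat.cast_add, Nat.cast_sub (by omega)]; push_cast; ring
  calc _ = ((s ^ (d - 1) : ℝ) : ℂ) * ∫ w : Metric.sphere (0 : EuclideanSpace ℝ (Fin d)) 1,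
        ((Real.exp (-s ^ 2 / 2) * s ^ q * eval (fun i => (w : EuclideanSpace ℝ (Fin d)) i) Q : ℝ) : ℂ)
          ∂((volume : Measure (EuclideanSpace ℝ (Fin d))).toSphere) := by
        congr 1
        exact integral_congr_ae (Filter.Eventually.of_forall h4)
    _ = ((s ^ (d - 1) * (Real.exp (-s ^ 2 / 2) * s ^ q * SI Q) : ℝ) : ℂ) := by
        rw [integral_complex_ofReal, integral_const_mul, ← Complex.ofReal_mul]; rfl
    _ = _ := by
        rw [h5]
        have : -(1 / 2) * s ^ (2 : ℝ) = -s ^ 2 / 2 := by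
          rw [Real.rpow_two]; ring
        rw [this]
        congr 1; ring

lemma SI_moment {d m : ℕ} (hd : 3 ≤ d) (α : ℝ) (hα : α = ((d : ℝ) - 2) / 2)
    {H : MvPolynomial (Fin d) ℝ} (hH : H.IsHomogeneous m) (hl : lap H = 0)
    (y : EuclideanSpace ℝ (Fin d)) (p : ℕ) :
    SI (H * Ly y ^ (m + 2 * p)) = (m + 2 * p).factorial / (2 ^ p * p.factorial) *
      (‖y‖ ^ (2 * p) * eval (fun i => y i) H * (2 * Real.pi) ^ ((d : ℝ) / 2)) *
      ((2 : ℝ) ^ (-(α + m)) / 2 ^ p / Real.Gamma (p + (α + m) + 1)) := by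
  have h1 := ((GI_moment y (m + 2 * p)) m H hH hl).1 p rfl
  rw [GI_one] at h1
  have hh : (H * Ly y ^ (m + 2 * p)).IsHomogeneous (m + (m + 2 * p)) := by
    simpa using hH.mul ((Ly_homog y).pow (m + 2 * p))
  have h2 := GI_eq_SI hd hh
  rw [← h1, h2]
  have e1 : (((m + (m + 2 * p) : ℕ) : ℝ) + d) / 2 = p + (α + m) + 1 := by
    rw [hα]; push_cast; ring
  have e2 : -(((m + (m + 2 * p) : ℕ) : ℝ) + d) / 2 = -((α + m) + p + 1) := by
    rw [hα]; push_cast; ring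
  have hd1 : (3 : ℝ) ≤ d := by exact_mod_cast hd
  have hα0 : 0 < α := by rw [hα]; linarith
  have hG : Real.Gamma (p + (α + m) + 1) ≠ 0 := (Real.Gamma_pos_of_pos (by positivity)).ne'
  rw [e1, e2, one_div, Real.inv_rpow (by norm_num), Real.rpow_neg (by norm_num), inv_inv,
    Real.rpow_add (by norm_num), Real.rpow_add (by norm_num), Real.rpow_neg (by norm_num),
    Real.rpow_one, Real.rpow_natCast]
  have : (2 : ℝ) ^ (α + m) ≠ 0 := by positivity
  field_simp

lemma SI_moment_zero {d m : ℕ} (hd : 3 ≤ d)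
    {H : MvPolynomial (Fin d) ℝ} (hH : H.IsHomogeneous m) (hl : lap H = 0)
    (y : EuclideanSpace ℝ (Fin d)) (n : ℕ) (hn : ∀ p, n ≠ m + 2 * p) :
    SI (H * Ly y ^ n) = 0 := by
  have h1 := ((GI_moment y n) m H hH hl).2 hn
  have hh : (H * Ly y ^ n).IsHomogeneous (m + n) := by
    simpa using hH.mul ((Ly_homog y).pow n)
  have h2 := GI_eq_SI hd hh
  rw [h1] at h2
  have hd1 : (0 : ℝ) < d := by exact_mod_cast (by omega : 0 < d)
  have hG : Real.Gamma ((((m + n : ℕ) : ℝ) + d) / 2) ≠ 0 := (Real.Gamma_pos_of_pos (by positivity)).ne'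
  have h3 : ((1 / 2 : ℝ) ^ (-(((m + n : ℕ) : ℝ) + d) / 2)) ≠ 0 := by positivity
  rcases mul_eq_zero.1 h2.symm with h | h
  · exact h
  · exact absurd h (mul_ne_zero (mul_ne_zero h3 (by norm_num)) hG)

lemma sphere_exp {d m : ℕ} (hd : 3 ≤ d) (α : ℝ) (hα : α = ((d : ℝ) - 2) / 2)
    {H : MvPolynomial (Fin d) ℝ} (hH : H.IsHomogeneous m) (hl : lap H = 0)
    (y : EuclideanSpace ℝ (Fin d)) (s : ℝ) :
    ∫ w : Metric.sphere (0 : EuclideanSpace ℝ (Fin d)) 1,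
      ((eval (fun i => (w : EuclideanSpace ℝ (Fin d)) i) H : ℝ) : ℂ) *
        Complex.exp (Complex.I * ((s * ⟪y, (w : EuclideanSpace ℝ (Fin d))⟫ : ℝ) : ℂ))
        ∂((volume : Measure (EuclideanSpace ℝ (Fin d))).toSphere) =
    Complex.I ^ m * ((s ^ m * eval (fun i => y i) H * (2 * Real.pi) ^ ((d : ℝ) / 2) *
      ((2 : ℝ) ^ (-(α + m)) / Real.Gamma ((α + m) + 1) * sphericalBesselJ (α + m) (s * ‖y‖)) : ℝ) : ℂ) := by
  set σ := (volume : Measure (EuclideanSpace ℝ (Fin d))).toSphere with hσ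
  let F : ℕ → Metric.sphere (0 : EuclideanSpace ℝ (Fin d)) 1 → ℂ := fun n w =>
    (Complex.I * s) ^ n / n.factorial *
      ((eval (fun i => (w : EuclideanSpace ℝ (Fin d)) i) (H * Ly y ^ n) : ℝ) : ℂ)
  have hcont : ∀ n, Continuous (F n) := by
    intro n
    have : Continuous (fun w : Metric.sphere (0 : EuclideanSpace ℝ (Fin d)) 1 =>
      eval (fun i => (w : EuclideanSpace ℝ (Fin d)) i) (H * Ly y ^ n)) :=
      (continuous_evalE _).comp continuous_subtype_val
    exact continuous_const.mul (Complex.continuous_ofReal.comp this)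
  have hFint : ∀ n, Integrable (F n) σ := fun n =>
    (hcont n).integrable_of_hasCompactSupport (HasCompactSupport.of_compactSpace _)
  obtain ⟨c, N, hc, hb⟩ := poly_bound H
  have hbd : ∀ n w, ‖F n w‖ ≤ (|s| * ‖y‖) ^ n / n.factorial * (c * 2 ^ N) := by
    intro n w
    have hw : ‖(w : EuclideanSpace ℝ (Fin d))‖ = 1 := by simp
    have h1 := hb w
    rw [hw] at h1
    have h2 : |⟪y, (w : EuclideanSpace ℝ (Fin d))⟫| ≤ ‖y‖ := by
      simpa [hw] using abs_real_inner_le_norm y (w : EuclideanSpace ℝ (Fin d))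
    simp only [F]
    rw [map_mul, map_pow, eval_Ly]
    simp only [norm_mul, norm_div, norm_pow, Complex.norm_I, Complex.norm_real, Real.norm_eq_abs,
      one_mul, Complex.norm_natCast, abs_mul, abs_pow]
    calc |s| ^ n / n.factorial * (|eval (fun i => (w : EuclideanSpace ℝ (Fin d)) i) H| *
          |⟪y, (w : EuclideanSpace ℝ (Fin d))⟫| ^ n) ≤
        |s| ^ n / n.factorial * ((c * (1 + 1) ^ N) * ‖y‖ ^ n) := by gcongr
      _ = _ := by rw [mul_pow]; norm_num; ring
  have hsum : Summable fun n => ∫ w, ‖F n w‖ ∂σ := by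
    have h1 : Summable fun n : ℕ => (|s| * ‖y‖) ^ n / n.factorial * (c * 2 ^ N) * σ.real Set.univ :=
      ((Real.summable_pow_div_factorial _).mul_right _).mul_right _
    refine Summable.of_nonneg_of_le (fun n => integral_nonneg fun w => norm_nonneg _) (fun n => ?_) h1
    calc ∫ w, ‖F n w‖ ∂σ ≤ ∫ w, (|s| * ‖y‖) ^ n / n.factorial * (c * 2 ^ N) ∂σ :=
          integral_mono (hFint n).norm (integrable_const _) (hbd n)
      _ = _ := by simp [mul_comm]
  have hS := hasSum_integral_of_summable_integral_norm hFint hsum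
  have hF : ∀ w, ∑' n, F n w = ((eval (fun i => (w : EuclideanSpace ℝ (Fin d)) i) H : ℝ) : ℂ) *
        Complex.exp (Complex.I * ((s * ⟪y, (w : EuclideanSpace ℝ (Fin d))⟫ : ℝ) : ℂ)) := by
    intro w
    rw [Complex.exp_eq_exp_ℂ, NormedSpace.exp_eq_tsum_div, ← tsum_mul_left]
    apply tsum_congr
    intro n
    simp only [F]
    rw [map_mul, map_pow, eval_Ly]
    push_cast
    ring
  simp_rw [hF] at hS
  have hI : ∀ n, ∫ w, F n w ∂σ = (Complex.I * s) ^ n / n.factorial * ((SI (H * Ly y ^ n) : ℝ) : ℂ) := by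
    intro n
    simp only [F]
    rw [integral_const_mul, integral_complex_ofReal]; rfl
  simp_rw [hI] at hS
  have hinj : Function.Injective (fun p : ℕ => m + 2 * p) := fun a b h => by
    simp only at h; omega
  rw [← hinj.hasSum_iff (fun n hn => by
    rw [SI_moment_zero hd hH hl y n (fun p hp => hn ⟨p, hp.symm⟩)]; simp)] at hS
  rw [← hS.tsum_eq]
  have hterm : ∀ p : ℕ, ((fun n : ℕ => (Complex.I * s) ^ n / n.factorial * ((SI (H * Ly y ^ n) : ℝ) : ℂ)) ∘
      (fun p : ℕ => m + 2 * p)) p = Complex.I ^ m * ((s ^ m * eval (fun i => y i) H *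
      (2 * Real.pi) ^ ((d : ℝ) / 2) * (2 : ℝ) ^ (-(α + m)) *
      ((-1) ^ p / (Real.Gamma (p + 1) * Real.Gamma (p + (α + m) + 1)) * (s * ‖y‖ / 2) ^ (2 * p)) : ℝ) : ℂ) := by
    intro p
    simp only [Function.comp]
    rw [SI_moment hd α hα hH hl y p, Real.Gamma_nat_eq_factorial]
    have hI2 : Complex.I ^ (m + 2 * p) = Complex.I ^ m * (((-1) ^ p : ℝ) : ℂ) := by
      rw [pow_add, pow_mul, Complex.I_sq]; push_cast; rfl
    have e : (Complex.I * (s : ℂ)) ^ (m + 2 * p) / ((m + 2 * p).factorial : ℂ) =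
        Complex.I ^ m * (((-1) ^ p * s ^ (m + 2 * p) / (m + 2 * p).factorial : ℝ) : ℂ) := by
      rw [mul_pow, hI2]; push_cast; ring
    rw [e, mul_assoc, ← Complex.ofReal_mul]
    congr 2
    have h1 := Nat.factorial_pos (m + 2 * p)
    have h2 := Nat.factorial_pos p
    have e3 : (s * ‖y‖ / 2) ^ (2 * p) = s ^ (2 * p) * ‖y‖ ^ (2 * p) / (2 ^ p * 2 ^ p) := by
      rw [div_pow, mul_pow, ← pow_add, two_mul]
    rw [e3, pow_add]
    field_simp
  rw [tsum_congr hterm, tsum_mul_left, ← Complex.ofReal_tsum, tsum_mul_left]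
  congr 2
  unfold sphericalBesselJ
  have hd1 : (3 : ℝ) ≤ d := by exact_mod_cast hd
  have hα0 : 0 < α := by rw [hα]; linarith
  have hG : Real.Gamma (α + m + 1) ≠ 0 := (Real.Gamma_pos_of_pos (by positivity)).ne'
  field_simp

lemma harmonic_case {d m : ℕ} (hd : 3 ≤ d) (α : ℝ) (hα : α = ((d : ℝ) - 2) / 2)
    {H : MvPolynomial (Fin d) ℝ} (hH : H.IsHomogeneous m) (hl : lap H = 0)
    {g : ℝ → ℝ} (hg : Decay g) (y : EuclideanSpace ℝ (Fin d)) :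
    Integrable (fun x : EuclideanSpace ℝ (Fin d) => ((g ‖x‖ * eval (fun i => x i) H : ℝ) : ℂ) *
            Complex.exp (Complex.I * ((⟪y, x⟫ : ℝ) : ℂ))) ∧
    ∫ x : EuclideanSpace ℝ (Fin d),
          ((g ‖x‖ * eval (fun i => x i) H : ℝ) : ℂ) *
            Complex.exp (Complex.I * ((⟪y, x⟫ : ℝ) : ℂ)) =
      Complex.I ^ m * (((2 * Real.pi) ^ ((d : ℝ) / 2) * (hankel (α + m) g ‖y‖ * eval (fun i => y i) H) : ℝ) : ℂ) := by
  have hi : Integrable (fun x : EuclideanSpace ℝ (Fin d) => ((g ‖x‖ * eval (fun i => x i) H : ℝ) : ℂ) *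
            Complex.exp (Complex.I * ((⟪y, x⟫ : ℝ) : ℂ))) := by
    refine (integrable_decay hg H).ofReal.mul_bdd (c := 1) ?_ ?_
    · exact (by fun_prop : Continuous fun x : EuclideanSpace ℝ (Fin d) =>
        Complex.exp (Complex.I * ((⟪y, x⟫ : ℝ) : ℂ))).aestronglyMeasurable
    · filter_upwards with x
      rw [mul_comm, Complex.norm_exp_ofReal_mul_I]
  refine ⟨hi, ?_⟩
  rw [polar hd hi]
  unfold hankel
  have key : ∀ s ∈ Set.Ioi (0 : ℝ), ((s ^ (d - 1) : ℝ) : ℂ) *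
      ∫ w : Metric.sphere (0 : EuclideanSpace ℝ (Fin d)) 1,
        ((g ‖s • (w : EuclideanSpace ℝ (Fin d))‖ *
          eval (fun i => (s • (w : EuclideanSpace ℝ (Fin d))) i) H : ℝ) : ℂ) *
            Complex.exp (Complex.I * ((⟪y, s • (w : EuclideanSpace ℝ (Fin d))⟫ : ℝ) : ℂ))
        ∂((volume : Measure (EuclideanSpace ℝ (Fin d))).toSphere) =
      (Complex.I ^ m * (((2 * Real.pi) ^ ((d : ℝ) / 2) * ((2 : ℝ) ^ (-(α + m)) / Real.Gamma ((α + m) + 1) *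
        eval (fun i => y i) H) : ℝ) : ℂ)) *
      ((g s * sphericalBesselJ (α + m) (s * ‖y‖) * s ^ (2 * (α + m) + 1) : ℝ) : ℂ) := by
    intro s hs
    have hs0 : 0 < s := hs
    have h4 : ∀ w : Metric.sphere (0 : EuclideanSpace ℝ (Fin d)) 1,
      ((g ‖s • (w : EuclideanSpace ℝ (Fin d))‖ *
          eval (fun i => (s • (w : EuclideanSpace ℝ (Fin d))) i) H : ℝ) : ℂ) *
            Complex.exp (Complex.I * ((⟪y, s • (w : EuclideanSpace ℝ (Fin d))⟫ : ℝ) : ℂ)) =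
      ((g s * s ^ m : ℝ) : ℂ) * (((eval (fun i => (w : EuclideanSpace ℝ (Fin d)) i) H : ℝ) : ℂ) *
        Complex.exp (Complex.I * ((s * ⟪y, (w : EuclideanSpace ℝ (Fin d))⟫ : ℝ) : ℂ))) := by
      intro w
      rw [eval_smul_homog hH, norm_smul, inner_smul_right]
      have : ‖(w : EuclideanSpace ℝ (Fin d))‖ = 1 := by simp
      rw [this, Real.norm_eq_abs, abs_of_pos hs0, mul_one]
      push_cast
      ring
    rw [integral_congr_ae (Filter.Eventually.of_forall h4), integral_const_mul,
      sphere_exp hd α hα hH hl y s]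
    have h5 : s ^ (2 * (α + m) + 1) = s ^ (d - 1) * s ^ m * s ^ m := by
      rw [← pow_add, ← pow_add, ← Real.rpow_natCast]
      congr 1
      rw [Nat.cast_add, Nat.cast_add, Nat.cast_sub (by omega), hα]; push_cast; ring
    rw [h5]
    push_cast
    ring
  rw [setIntegral_congr_fun measurableSet_Ioi key, integral_const_mul, integral_complex_ofReal]
  push_cast
  ring

lemma eval_r2 {d : ℕ} (x : EuclideanSpace ℝ (Fin d)) : eval (fun i => x i) (r2 d) = ‖x‖ ^ 2 := by
  rw [EuclideanSpace.norm_sq_eq]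
  simp [r2, pow_two]

/-- **Generalized Bochner identity, first form (Corollary 4).** For a homogeneous polynomial
`P` of degree `l` on `ℝ^d` (`d ≥ 3`, `α = (d-2)/2`) and a Schwartz function `f`:
`(2π)^{-d/2} ∫_{ℝ^d} f(|x|)P(x)e^{i(y|x)} dx
  = i^l Σ_{k=0}^{⌊l/2⌋} (-1)^k H_{α+l-2k}(s^{2k}f)(|y|) h_{l-2k}(P)(y)`. -/
theorem generalized_bochner_first_form (d l : ℕ) (hd : 3 ≤ d)
    (α : ℝ) (hα : α = ((d : ℝ) - 2) / 2)
    (P : MvPolynomial (Fin d) ℝ) (hP : P.IsHomogeneous l)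
    (f : 𝓢(ℝ, ℝ)) (y : EuclideanSpace ℝ (Fin d)) :
    ((2 * Real.pi : ℝ) ^ (-(d : ℝ) / 2) : ℝ) *
        ∫ x : EuclideanSpace ℝ (Fin d),
          ((f ‖x‖ * eval (fun i => x i) P : ℝ) : ℂ) *
            Complex.exp (Complex.I * ((⟪y, x⟫ : ℝ) : ℂ)) =
      Complex.I ^ l *
        ∑ k ∈ Finset.range (l / 2 + 1),
          (((-1 : ℝ) ^ k * hankel (α + l - 2 * k) (fun s => s ^ (2 * k) * f s) ‖y‖ *
              eval (fun i => y i) (harmComp d α l k P) : ℝ) : ℂ) := by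
  have hd1 : (3 : ℝ) ≤ d := by exact_mod_cast hd
  have hk : ∀ k ∈ Finset.range (l / 2 + 1), k ≤ l / 2 := fun k hk => by
    rw [Finset.mem_range] at hk; omega
  have hc := fun k (h : k ∈ Finset.range (l / 2 + 1)) =>
    harmonic_case hd α hα (harmComp_homog α hP (hk k h)) (harmComp_harmonic hd α hα hP (hk k h))
      (decay_schwartz f k) y
  have hx : ∀ x : EuclideanSpace ℝ (Fin d), ((f ‖x‖ * eval (fun i => x i) P : ℝ) : ℂ) *
            Complex.exp (Complex.I * ((⟪y, x⟫ : ℝ) : ℂ)) =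
      ∑ k ∈ Finset.range (l / 2 + 1),
        ((‖x‖ ^ (2 * k) * f ‖x‖ * eval (fun i => x i) (harmComp d α l k P) : ℝ) : ℂ) *
            Complex.exp (Complex.I * ((⟪y, x⟫ : ℝ) : ℂ)) := by
    intro x
    rw [← Finset.sum_mul, ← Complex.ofReal_sum]
    congr 2
    conv_lhs => rw [← decomp (l := l) hd α hα (P := P)]
    rw [map_sum, Finset.mul_sum]
    apply Finset.sum_congr rfl
    intro k _
    rw [map_mul, map_pow, eval_r2, pow_mul]
    ring
  simp_rw [hx]
  rw [integral_finsetSum _ (fun k h => (hc k h).1), Finset.mul_sum, Finset.mul_sum]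
  apply Finset.sum_congr rfl
  intro k h
  rw [(hc k h).2]
  have h2k : 2 * k ≤ l := by have := hk k h; omega
  have e1 : α + ((l - 2 * k : ℕ) : ℝ) = α + l - 2 * k := by
    rw [Nat.cast_sub h2k]; push_cast; ring
  have e2 : Complex.I ^ l = Complex.I ^ (l - 2 * k) * (-1) ^ k := by
    conv_lhs => rw [← Nat.sub_add_cancel h2k]
    rw [pow_add, pow_mul, Complex.I_sq]
  have e3 : ((-1 : ℂ) ^ k) * (-1) ^ k = 1 := by
    rw [← mul_pow]; simp
  have e4 : (2 * Real.pi : ℝ) ^ (-(d : ℝ) / 2) * (2 * Real.pi) ^ ((d : ℝ) / 2) = 1 := by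
    rw [← Real.rpow_add (by positivity)]
    rw [show -(d : ℝ) / 2 + d / 2 = 0 by ring, Real.rpow_zero]
  have e5 : (((2 * Real.pi : ℝ) ^ (-(d : ℝ) / 2) : ℝ) : ℂ) * (((2 * Real.pi) ^ ((d : ℝ) / 2) : ℝ) : ℂ) = 1 := by
    rw [← Complex.ofReal_mul, e4, Complex.ofReal_one]
  rw [e1, e2]
  generalize hankel (α + l - 2 * k) (fun s => s ^ (2 * k) * f s) ‖y‖ = hh
  generalize eval (fun i => y i) (harmComp d α l k P) = ee
  rw [Complex.ofReal_mul, Complex.ofReal_mul, Complex.ofReal_mul, Complex.ofReal_mul]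
  push_cast at e5 ⊢
  linear_combination (Complex.I ^ (l - 2 * k) * hh * ee) * e5 - (Complex.I ^ (l - 2 * k) * hh * ee) * e3

end
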